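/- arXiv:2001.00858 — 4 statements merged into one kernel-verified Lean document; each statement's English description precedes it below -/
import Mathlib

section
/- Equivalence of the two linear relaxations (Theorem 1): Let x : A → ℝ satisfy the flow-balance constraints (b105): for every i ∈ S ∪ P, Σ_{j ∈ δ⁺(i)} x_{ij} = Σ_{j ∈ δ⁻(i)} x_{ji}. Let z : A → ℝ and define f : A → ℝ by f_{ij} = T·x_{ij} − z_{ij} for every (i,j) ∈ A. Then z satisfies all of the constraints (b106) z_{sj} = d_{sj}·x_{sj} for all j ∈ δ⁺(s); (b107) Σ_{j ∈ δ⁺(i)} z_{ij} − Σ_{j ∈ δ⁻(i)} z_{ji} = Σ_{j ∈ δ⁺(i)} d_{ij}·x_{ij} for all i ∈ S ∪ P; (b108) z_{ij} ≤ (T − R_{jt})·x_{ij} for all (i,j) ∈ A; and (b109) z_{ij} ≥ (R_{si} + d_{ij})·x_{ij} for all (i,j) ∈ A — if and only if f satisfies all of the constraints (csc107) f_{sj} = (T − d_{sj})·x_{sj} for all j ∈ δ⁺(s); (csc108) Σ_{j ∈ δ⁻(i)} f_{ji} − Σ_{j ∈ δ⁺(i)} f_{ij} = Σ_{j ∈ δ⁺(i)}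 d_{ij}·x_{ij} for all i ∈ S ∪ P; (csc109) f_{ij} ≤ (T − R_{si} − d_{ij})·x_{ij} for all (i,j) ∈ A with i ≠ s; and (csc110) f_{ij} ≥ R_{jt}·x_{ij} for all (i,j) ∈ A. -/
open Finset

/-- Theorem 1: equivalence of the two linear relaxations.  Under the
flow-balance constraints (b105) and the substitution `f = T·x − z`, the
constraints (b106)–(b109) of `𝓛₁` hold iff the constraints
(csc107)–(csc110) of `𝓛₂` hold. -/
theorem relaxation_equivalence
    {N : Type*} [Fintype N] [DecidableEq N]
    (A : Finset (N × N)) (s t : N) (S P : Finset N)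
    (d : N × N → ℝ) (T : ℝ) (R : N × N → ℝ)
    (hst : s ≠ t)
    (hSP : Disjoint S P)
    (hpart : S ∪ P = Finset.univ \ ({s, t} : Finset N))
    (hd : ∀ e ∈ A, 0 ≤ d e) (hT : 0 ≤ T)
    (hR : ∀ u v : N, 0 ≤ R (u, v)) (hRss : R (s, s) = 0)
    (x z f : N × N → ℝ)
    -- (b105): flow balance
    (hbal : ∀ i ∈ S ∪ P,
      ∑ j ∈ univ.filter (fun j => (i, j) ∈ A), x (i, j)
        = ∑ j ∈ univ.filter (fun j => (j, i) ∈ A), x (j, i))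
    -- the substitution f_{ij} = T·x_{ij} − z_{ij} on every arc
    (hf : ∀ e ∈ A, f e = T * x e - z e) :
    ( -- (b106)
      (∀ j : N, (s, j) ∈ A → z (s, j) = d (s, j) * x (s, j)) ∧
      -- (b107)
      (∀ i ∈ S ∪ P,
        ∑ j ∈ univ.filter (fun j => (i, j) ∈ A), z (i, j)
          - ∑ j ∈ univ.filter (fun j => (j, i) ∈ A), z (j, i)
        = ∑ j ∈ univ.filter (fun j => (i, j) ∈ A), d (i, j) * x (i, j)) ∧
      -- (b108)
      (∀ e ∈ A, z e ≤ (T - R (e.2, t)) * x e) ∧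
      -- (b109)
      (∀ e ∈ A, (R (s, e.1) + d e) * x e ≤ z e) )
    ↔
    ( -- (csc107)
      (∀ j : N, (s, j) ∈ A → f (s, j) = (T - d (s, j)) * x (s, j)) ∧
      -- (csc108)
      (∀ i ∈ S ∪ P,
        ∑ j ∈ univ.filter (fun j => (j, i) ∈ A), f (j, i)
          - ∑ j ∈ univ.filter (fun j => (i, j) ∈ A), f (i, j)
        = ∑ j ∈ univ.filter (fun j => (i, j) ∈ A), d (i, j) * x (i, j)) ∧
      -- (csc109)
      (∀ e ∈ A, e.1 ≠ s → f e ≤ (T - R (s, e.1) - d e) * x e) ∧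
      -- (csc110)
      (∀ e ∈ A, R (e.2, t) * x e ≤ f e) ) := by
  have hout : ∀ i, ∑ j ∈ univ.filter (fun j => (i, j) ∈ A), f (i, j)
      = T * ∑ j ∈ univ.filter (fun j => (i, j) ∈ A), x (i, j)
        - ∑ j ∈ univ.filter (fun j => (i, j) ∈ A), z (i, j) := by
    intro i
    rw [mul_sum, ← sum_sub_distrib]
    exact sum_congr rfl fun j hj => hf _ (mem_filter.mp hj).2
  have hin : ∀ i, ∑ j ∈ univ.filter (fun j => (j, i) ∈ A), f (j, i)
      = T * ∑ j ∈ univ.filter (fun j => (j, i) ∈ A), x (j, i)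
        - ∑ j ∈ univ.filter (fun j => (j, i) ∈ A), z (j, i) := by
    intro i
    rw [mul_sum, ← sum_sub_distrib]
    exact sum_congr rfl fun j hj => hf _ (mem_filter.mp hj).2
  have hnet : ∀ i ∈ S ∪ P,
      ∑ j ∈ univ.filter (fun j => (j, i) ∈ A), f (j, i)
          - ∑ j ∈ univ.filter (fun j => (i, j) ∈ A), f (i, j)
        = ∑ j ∈ univ.filter (fun j => (i, j) ∈ A), z (i, j)
          - ∑ j ∈ univ.filter (fun j => (j, i) ∈ A), z (j, i) := by
    intro i hi
    rw [hout, hin, hbal i hi]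
    ring
  constructor
  · rintro ⟨hsrc, hflow, hub, hlb⟩
    refine ⟨fun j hj => ?_, fun i hi => (hnet i hi).trans (hflow i hi),
      fun e he _ => ?_, fun e he => ?_⟩
    · rw [hf _ hj, hsrc j hj]
      ring
    · linarith [hf e he, hlb e he]
    · linarith [hf e he, hub e he]
  · rintro ⟨hsrc, hflow, hub, hlb⟩
    have hsrc_z : ∀ j : N, (s, j) ∈ A → z (s, j) = d (s, j) * x (s, j) :=
      fun j hj => by linarith [hf _ hj, hsrc j hj]
    refine ⟨hsrc_z, fun i hi => (hnet i hi).symm.trans (hflow i hi),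
      fun e he => ?_, fun e he => ?_⟩
    · linarith [hf e he, hlb e he]
    · by_cases hes : e.1 = s
      · obtain ⟨i, j⟩ := e
        obtain rfl : i = s := hes
        rw [hsrc_z j he, hRss, zero_add]
      · linarith [hf e he, hub e he hes]
end

section
/- Proposition 1: Suppose x : A → ℝ with x ≥ 0, f : A → ℝ with f ≥ 0, and φ ∈ ℝ with φ ≥ 0 satisfy: (b103) Σ_{j ∈ δ⁺(s)} x_{sj} = m − φ; (b104) x_{is} = 0 for every arc (i,s) ∈ A and x_{tj} = 0 for every arc (t,j) ∈ A; (csc107) f_{sj} = (T − d_{sj})·x_{sj} for all j ∈ δ⁺(s); (csc108) Σ_{j ∈ δ⁻(i)} f_{ji} − Σ_{j ∈ δ⁺(i)} f_{ij} = Σ_{j ∈ δ⁺(i)} d_{ij}·x_{ij} for all i ∈ S ∪ P; and (csc109) f_{ij} ≤ (T − R_{si} − d_{ij})·x_{ij} for all (i,j) ∈ A with i ≠ s. Then Σ_{(i,j) ∈ A} d_{ij}·x_{ij} ≤ m·T. In other words, the inequality Σ_{(i,j) ∈ A} d_{ij} x_{ij} ≤ mT does not cut off any point of the linear relaxation of the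 commodity-based formulation 𝓕₂. -/
open Finset

/-- A sum over the arcs of a digraph, grouped by tails. -/
theorem sum_arcs_eq_sum_out {N : Type*} [Fintype N] [DecidableEq N]
    (A : Finset (N × N)) (g : N × N → ℝ) :
    ∑ e ∈ A, g e = ∑ i, ∑ j ∈ univ.filter (fun j => (i, j) ∈ A), g (i, j) := by
  simp_rw [Finset.sum_filter]
  rw [← Fintype.sum_prod_type' (fun i j => if (i, j) ∈ A then g (i, j) else 0)]
  simp

/-- A sum over the arcs of a digraph, grouped by heads. -/
theorem sum_arcs_eq_sum_in {N : Type*} [Fintype N] [DecidableEq N]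
    (A : Finset (N × N)) (g : N × N → ℝ) :
    ∑ e ∈ A, g e = ∑ i, ∑ j ∈ univ.filter (fun j => (j, i) ∈ A), g (j, i) := by
  simp_rw [sum_arcs_eq_sum_out, Finset.sum_filter]
  exact Finset.sum_comm

/-- Proposition 1: any point of the linear relaxation of the
commodity-based formulation `𝓕₂` satisfies
`Σ_{(i,j)∈A} d_{ij} x_{ij} ≤ m·T`. -/
theorem prop1_F2_satisfies_mT
    {N : Type*} [Fintype N] [DecidableEq N]
    (A : Finset (N × N)) (s t : N) (S P : Finset N)
    (d : N × N → ℝ) (T m : ℝ) (R : N × N → ℝ)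
    (hst : s ≠ t)
    (hSP : Disjoint S P)
    (hpart : S ∪ P = Finset.univ \ ({s, t} : Finset N))
    (hd : ∀ e ∈ A, 0 ≤ d e) (hT : 0 ≤ T) (hm : 0 ≤ m)
    (hR : ∀ u v : N, 0 ≤ R (u, v)) (hRss : R (s, s) = 0)
    (x f : N × N → ℝ) (φ : ℝ)
    (hx : ∀ e ∈ A, 0 ≤ x e) (hfnn : ∀ e ∈ A, 0 ≤ f e) (hφ : 0 ≤ φ)
    -- (b103)
    (hb103 : ∑ j ∈ univ.filter (fun j => (s, j) ∈ A), x (s, j) = m - φ)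
    -- (b104)
    (hb104s : ∀ i : N, (i, s) ∈ A → x (i, s) = 0)
    (hb104t : ∀ j : N, (t, j) ∈ A → x (t, j) = 0)
    -- (csc107)
    (hcsc107 : ∀ j : N, (s, j) ∈ A → f (s, j) = (T - d (s, j)) * x (s, j))
    -- (csc108)
    (hcsc108 : ∀ i ∈ S ∪ P,
      ∑ j ∈ univ.filter (fun j => (j, i) ∈ A), f (j, i)
        - ∑ j ∈ univ.filter (fun j => (i, j) ∈ A), f (i, j)
      = ∑ j ∈ univ.filter (fun j => (i, j) ∈ A), d (i, j) * x (i, j))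
    -- (csc109)
    (hcsc109 : ∀ e ∈ A, e.1 ≠ s → f e ≤ (T - R (s, e.1) - d e) * x e) :
    ∑ e ∈ A, d e * x e ≤ m * T := by
  have key : ∀ i, ∑ j ∈ univ.filter (fun j => (i, j) ∈ A), d (i, j) * x (i, j)
      + ∑ j ∈ univ.filter (fun j => (i, j) ∈ A), f (i, j)
      ≤ ∑ j ∈ univ.filter (fun j => (j, i) ∈ A), f (j, i)
        + if i = s then T * (m - φ) else 0 := by
    intro i
    have hin : 0 ≤ ∑ j ∈ univ.filter (fun j => (j, i) ∈ A), f (j, i) :=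
      Finset.sum_nonneg fun j hj => hfnn _ (Finset.mem_filter.mp hj).2
    by_cases his : i = s
    · subst his
      have hout : ∑ j ∈ univ.filter (fun j => (i, j) ∈ A), d (i, j) * x (i, j)
          + ∑ j ∈ univ.filter (fun j => (i, j) ∈ A), f (i, j) = T * (m - φ) := by
        rw [← hb103, Finset.mul_sum, ← Finset.sum_add_distrib]
        refine Finset.sum_congr rfl fun j hj => ?_
        rw [hcsc107 j (Finset.mem_filter.mp hj).2]
        ring
      rw [if_pos rfl]
      linarith
    · rw [if_neg his]
      by_cases hit : i = t
      · subst hit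
        have hout : ∑ j ∈ univ.filter (fun j => (i, j) ∈ A), d (i, j) * x (i, j)
            + ∑ j ∈ univ.filter (fun j => (i, j) ∈ A), f (i, j) ≤ 0 := by
          rw [← Finset.sum_add_distrib]
          refine Finset.sum_nonpos fun j hj => ?_
          have hA := (Finset.mem_filter.mp hj).2
          have hf := hcsc109 (i, j) hA his
          rw [hb104t j hA] at hf ⊢
          linarith
        linarith
      · have hbal := hcsc108 i (by rw [hpart]; simp [his, hit])
        linarith
  have hsum := Finset.sum_le_sum fun i (_ : i ∈ univ) => key i
  rw [Finset.sum_add_distrib, Finset.sum_add_distrib,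
    ← sum_arcs_eq_sum_out A (fun e => d e * x e), ← sum_arcs_eq_sum_out, ← sum_arcs_eq_sum_in,
    Finset.sum_ite_eq' univ s, if_pos (Finset.mem_univ s)] at hsum
  nlinarith [mul_nonneg hT hφ]
end

section
/- Two-path distinct entering arcs (the key step in case 4 of the proof of Proposition 2): Let V ⊆ N with s ∉ V. Let P₁ and P₂ be two directed s–t paths in G such that every vertex of N ∖ {s,t} lies on at most one of P₁, P₂. Let i, j ∈ N ∖ {s,t} with i ∈ V lying on P₁ and j ∈ V lying on P₂. Then there exist two distinct arcs e₁ ≠ e₂ with e₁, e₂ ∈ δ⁻(V), e₁ an arc of P₁ and e₂ an arc of P₂. -/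
/-- A directed s–t path in the digraph with arc set `A`: a nonempty list
of vertices starting at `s`, ending at `t`, with no repeated vertices,
whose consecutive pairs are arcs of `A`. -/
def IsSTPath {N : Type*} (A : Finset (N × N)) (s t : N) (r : List N) : Prop :=
  r ≠ [] ∧ r.head? = some s ∧ r.getLast? = some t ∧ r.Nodup ∧
    List.Chain' (fun u v => (u, v) ∈ A) r

/-- A nodup chain that starts outside `V`, ends at `t` and meets `V` at a vertex other than `t`
has an arc entering `V` whose head is not `t`. -/
theorem exists_entering_arc_head_ne_last {N : Type*} {A : Finset (N × N)} {V : Finset N}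
    {t i : N} (hit : i ≠ t) (hiV : i ∈ V) :
    ∀ (l : List N) (a : N), a ∉ V → (a :: l).getLast? = some t → (a :: l).Nodup →
      List.IsChain (fun u v => (u, v) ∈ A) (a :: l) → i ∈ a :: l →
      ∃ e ∈ (a :: l).zip l, e ∈ A ∧ e.1 ∉ V ∧ e.2 ∈ V ∧ e.2 ≠ t
  | [], a, haV, _, _, _, hi => by
    obtain rfl := List.mem_singleton.1 hi
    exact absurd hiV haV
  | b :: l, a, haV, hlast, hnd, hch, hi => by
    obtain ⟨hab, hch⟩ := List.isChain_cons_cons.1 hch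
    have hnd := (List.nodup_cons.1 hnd).2
    rw [List.getLast?_cons_cons] at hlast
    have hi : i ∈ b :: l := (List.mem_cons.1 hi).resolve_left fun h => haV (h ▸ hiV)
    by_cases hbV : b ∈ V
    · refine ⟨(a, b), by simp, hab, haV, hbV, ?_⟩
      rintro rfl
      have hil : i ∈ l := (List.mem_cons.1 hi).resolve_left hit
      cases l with
      | nil => simp at hil
      | cons c l =>
        rw [List.getLast?_cons_cons] at hlast
        exact (List.nodup_cons.1 hnd).1 (List.mem_of_getLast? hlast)
    · obtain ⟨e, he, h⟩ := exists_entering_arc_head_ne_last hit hiV l b hbV hlast hnd hch hi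
      exact ⟨e, List.mem_cons_of_mem _ he, h⟩

/-- An s–t path that meets `V` at a vertex other than `t`, where `s ∉ V`, has an arc entering `V`
whose head is not `t`. -/
theorem IsSTPath.exists_entering_arc {N : Type*} {A : Finset (N × N)} {s t i : N} {V : Finset N}
    {P : List N} (hP : IsSTPath A s t P) (hsV : s ∉ V) (hit : i ≠ t) (hiV : i ∈ V) (hiP : i ∈ P) :
    ∃ e ∈ P.zip P.tail, e ∈ A ∧ e.1 ∉ V ∧ e.2 ∈ V ∧ e.2 ≠ t := by
  obtain ⟨-, hhead, hlast, hnd, hch⟩ := hP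
  cases P with
  | nil => simp at hiP
  | cons a l =>
    obtain rfl : a = s := by simpa using hhead
    exact exists_entering_arc_head_ne_last hit hiV l a hsV hlast hnd hch hiP

/-- Two-path distinct entering arcs (key step in case 4 of the proof of
Proposition 2): two s–t paths sharing no internal vertex, each meeting
`V` (with `s ∉ V`) at some internal vertex, must enter `V` through two
distinct arcs of `δ⁻(V)`. -/
theorem two_paths_distinct_entering_arcs
    {N : Type*} [DecidableEq N]
    (A : Finset (N × N)) (s t : N) (hst : s ≠ t)
    (V : Finset N) (hsV : s ∉ V)
    (P₁ P₂ : List N)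
    (hP₁ : IsSTPath A s t P₁) (hP₂ : IsSTPath A s t P₂)
    (hdisj : ∀ v : N, v ≠ s → v ≠ t → v ∈ P₁ → v ∉ P₂)
    (i j : N) (hi_ns : i ≠ s) (hi_nt : i ≠ t) (hj_ns : j ≠ s) (hj_nt : j ≠ t)
    (hiV : i ∈ V) (hiP : i ∈ P₁) (hjV : j ∈ V) (hjP : j ∈ P₂) :
    ∃ e₁ e₂ : N × N, e₁ ≠ e₂ ∧
      e₁ ∈ A ∧ e₁.1 ∉ V ∧ e₁.2 ∈ V ∧ e₁ ∈ P₁.zip P₁.tail ∧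
      e₂ ∈ A ∧ e₂.1 ∉ V ∧ e₂.2 ∈ V ∧ e₂ ∈ P₂.zip P₂.tail := by
  obtain ⟨e₁, he₁, hA₁, hout₁, hin₁, ht₁⟩ := hP₁.exists_entering_arc hsV hi_nt hiV hiP
  obtain ⟨e₂, he₂, hA₂, hout₂, hin₂, -⟩ := hP₂.exists_entering_arc hsV hj_nt hjV hjP
  refine ⟨e₁, e₂, ?_, hA₁, hout₁, hin₁, he₁, hA₂, hout₂, hin₂, he₂⟩
  rintro rfl
  exact hdisj e₁.2 (fun h => hsV (h ▸ hin₁)) ht₁ (List.mem_of_mem_tail (List.of_mem_zip he₁).2)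
    (List.mem_of_mem_tail (List.of_mem_zip he₂).2)
end

section
/- Corollary 2 (validity of the conflict cuts (cc01)): Let a feasible solution be given, consisting of routes r₁, …, r_k (k ≤ m), each an s–t directed path of total traverse time at most T, such that every vertex of N ∖ {s,t} lies on at most one route; define x : A → {0,1} and y : N → {0,1} by x_e = 1 iff arc e lies on some route and y_v = 1 iff vertex v lies on some route. Let i, j ∈ N ∖ {s,t} be a conflicting pair and let V ⊆ N be any subset with t ∉ V and i, j ∈ V. Then Σ_{e ∈ δ⁺(V)} x_e ≥ y_i + y_j. -/
open Finset
open scoped Classical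

/-- A route: a directed s–t path (nonempty list of vertices starting at
`s`, ending at `t`, no repeated vertices, consecutive pairs are arcs of
`A`) whose total traverse time is at most `T`. -/
def IsRoute {N : Type*} (A : Finset (N × N)) (d : N × N → ℝ) (T : ℝ)
    (s t : N) (r : List N) : Prop :=
  r ≠ [] ∧ r.head? = some s ∧ r.getLast? = some t ∧ r.Nodup ∧
    List.Chain' (fun u v => (u, v) ∈ A) r ∧ ((r.zip r.tail).map d).sum ≤ T

/-- A list that visits `V` and ends outside `V` has a consecutive pair leaving `V`. -/
theorem exists_mem_zip_tail_leaving {N : Type*} (V : Finset N) {t : N} (ht : t ∉ V) :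
    ∀ (l : List N) (i : N), i ∈ l → i ∈ V → l.getLast? = some t →
      ∃ e ∈ l.zip l.tail, e.1 ∈ V ∧ e.2 ∉ V
  | [], _, hi, _, _ => by simp at hi
  | [a], i, hi, hiV, hl => by
    simp only [List.mem_singleton, List.getLast?_singleton, Option.some.injEq] at hi hl
    subst hi hl
    exact absurd hiV ht
  | a :: b :: l, i, hi, hiV, hl => by
    have hl' : (b :: l).getLast? = some t := by simpa using hl
    have ih : ∀ k ∈ b :: l, k ∈ V → ∃ e ∈ (a :: b :: l).zip (b :: l), e.1 ∈ V ∧ e.2 ∉ V := by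
      intro k hk hkV
      obtain ⟨e, he, h⟩ := exists_mem_zip_tail_leaving V ht (b :: l) k hk hkV hl'
      exact ⟨e, List.mem_cons_of_mem _ he, h⟩
    rcases List.mem_cons.1 hi with rfl | hi
    · by_cases hb : b ∈ V
      · exact ih b List.mem_cons_self hb
      · exact ⟨(i, b), List.mem_cons_self, hiV, hb⟩
    · exact ih i hi hiV

theorem rel_of_mem_zip_tail {N : Type*} {R : N → N → Prop} :
    ∀ {l : List N}, l.IsChain R → ∀ e ∈ l.zip l.tail, R e.1 e.2
  | [], _, e, he => by simp at he
  | [a], _, e, he => by simp at he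
  | a :: b :: l, h, e, he => by
    rw [List.isChain_cons_cons] at h
    rcases List.mem_cons.1 he with rfl | he
    · exact h.1
    · exact rel_of_mem_zip_tail h.2 e he

/-- A route through an inner vertex of `V` leaves `V` along an arc whose tail is not the origin. -/
theorem IsRoute.exists_leaving_arc {N : Type*} {A : Finset (N × N)} {d : N × N → ℝ} {T : ℝ}
    {s t : N} {r : List N} (hr : IsRoute A d T s t r) {V : Finset N} (ht : t ∉ V)
    {i : N} (hi : i ∈ r) (his : i ≠ s) (hiV : i ∈ V) :
    ∃ e ∈ r.zip r.tail, e ∈ A ∧ e.1 ∈ V ∧ e.2 ∉ V ∧ e.1 ∈ r ∧ e.1 ≠ s := by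
  obtain ⟨-, hhead, hlast, hnodup, hchain, -⟩ := hr
  match r with
  | [] => simp at hi
  | [a] => simp_all
  | a :: b :: l =>
    obtain rfl : a = s := by simpa using hhead
    have hi' : i ∈ b :: l := (List.mem_cons.1 hi).resolve_left his
    obtain ⟨e, he, heV, heV'⟩ :=
      exists_mem_zip_tail_leaving V ht (b :: l) i hi' hiV (by simpa using hlast)
    have he' : e ∈ (a :: b :: l).zip (b :: l) := List.mem_cons_of_mem _ he
    have hmem : e.1 ∈ b :: l := (List.of_mem_zip (a := e.1) (b := e.2) he).1
    refine ⟨e, he', rel_of_mem_zip_tail hchain e he', heV, heV', List.mem_cons_of_mem _ hmem, ?_⟩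
    rintro rfl
    exact (List.nodup_cons.1 hnodup).1 hmem

/-- Corollary 2 (validity of the conflict cuts (cc01)): for a feasible
solution with routes `routes 0, …, routes (K-1)` (K ≤ m), a conflicting
pair `i, j` and any `V ⊆ N` with `t ∉ V` and `i, j ∈ V`, we have
`Σ_{e ∈ δ⁺(V)} x_e ≥ y_i + y_j`. -/
theorem conflict_cut_cc01
    {N : Type*} [Fintype N] [DecidableEq N]
    (A : Finset (N × N)) (s t : N) (hst : s ≠ t)
    (d : N × N → ℝ) (hd : ∀ e ∈ A, 0 ≤ d e) (T : ℝ) (hT : 0 ≤ T)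
    (m K : ℕ) (hK : K ≤ m)
    (routes : Fin K → List N)
    (hroutes : ∀ a : Fin K, IsRoute A d T s t (routes a))
    (hdisj : ∀ v : N, v ≠ s → v ≠ t →
      ∀ a b : Fin K, v ∈ routes a → v ∈ routes b → a = b)
    (x : N × N → ℝ) (y : N → ℝ)
    (hx : ∀ e : N × N,
      x e = if ∃ a : Fin K, e ∈ (routes a).zip (routes a).tail then 1 else 0)
    (hy : ∀ v : N, y v = if ∃ a : Fin K, v ∈ routes a then 1 else 0)
    (i j : N) (hi_ns : i ≠ s) (hi_nt : i ≠ t) (hj_ns : j ≠ s) (hj_nt : j ≠ t)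
    (hij : i ≠ j)
    -- ⟨i,j⟩ is a conflicting pair: no single route contains both
    (hconf : ∀ r : List N, IsRoute A d T s t r → ¬ (i ∈ r ∧ j ∈ r))
    (V : Finset N) (htV : t ∉ V) (hiV : i ∈ V) (hjV : j ∈ V) :
    y i + y j ≤ ∑ e ∈ A.filter (fun e => e.1 ∈ V ∧ e.2 ∉ V), x e := by
  set S := A.filter (fun e => e.1 ∈ V ∧ e.2 ∉ V) with hS
  have hx0 : ∀ e, 0 ≤ x e := fun e => by rw [hx]; split_ifs <;> norm_num
  have leaving : ∀ k ∈ V, k ≠ s → ∀ a, k ∈ routes a →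
      ∃ e ∈ S, x e = 1 ∧ e.1 ∈ routes a ∧ e.1 ≠ s ∧ e.1 ≠ t := by
    intro k hkV hks a hka
    obtain ⟨e, he, heA, heV, heV', hmem, hes⟩ :=
      (hroutes a).exists_leaving_arc htV hka hks hkV
    refine ⟨e, by simp [hS, heA, heV, heV'], ?_, hmem, hes, ?_⟩
    · rw [hx, if_pos ⟨a, he⟩]
    · rintro h
      exact htV (h ▸ heV)
  have one_le : ∀ k ∈ V, k ≠ s → (∃ a, k ∈ routes a) → 1 ≤ ∑ e ∈ S, x e := by
    rintro k hkV hks ⟨a, hka⟩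
    obtain ⟨e, heS, hxe, -⟩ := leaving k hkV hks a hka
    exact hxe ▸ Finset.single_le_sum (fun e _ => hx0 e) heS
  rw [hy i, hy j]
  by_cases hi : ∃ a, i ∈ routes a <;> by_cases hj : ∃ a, j ∈ routes a
  · rw [if_pos hi, if_pos hj]
    obtain ⟨a, ha⟩ := hi
    obtain ⟨b, hb⟩ := hj
    obtain ⟨e, heS, hxe, hea, hes, het⟩ := leaving i hiV hi_ns a ha
    obtain ⟨f, hfS, hxf, hfb, -, -⟩ := leaving j hjV hj_ns b hb
    have hef : e ≠ f := by
      rintro rfl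
      obtain rfl := hdisj e.1 hes het a b hea hfb
      exact hconf _ (hroutes a) ⟨ha, hb⟩
    calc (1 : ℝ) + 1 = ∑ g ∈ {e, f}, x g := by rw [Finset.sum_pair hef, hxe, hxf]
      _ ≤ ∑ g ∈ S, x g := Finset.sum_le_sum_of_subset_of_nonneg
          (by simp [Finset.insert_subset_iff, heS, hfS]) (fun g _ _ => hx0 g)
  · rw [if_pos hi, if_neg hj, add_zero]
    exact one_le i hiV hi_ns hi
  · rw [if_neg hi, if_pos hj, zero_add]
    exact one_le j hjV hj_ns hj
  · rw [if_neg hi, if_neg hj, add_zero]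
    exact Finset.sum_nonneg fun e _ => hx0 e
end
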